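/- arXiv:2011.11810 — 6 statements merged into one kernel-verified Lean document; each statement's English description precedes it below -/
import Mathlib

section
/- Let P and Q be nonempty compact convex subsets of ℝⁿ, each having only finitely many extreme points. Then the number of extreme points of the Minkowski sum P + Q is at least the maximum of the number of extreme points of P and the number of extreme points of Q. -/
open Pointwise

theorem aux_unique {n : ℕ} {P Q : Set (Fin n → ℝ)} {a b c d : Fin n → ℝ}
    (ha : a ∈ P) (hb : b ∈ Q) (hc : c ∈ P) (hd : d ∈ Q)
    (h : a + b ∈ (P + Q).extremePoints ℝ) (he : a + b = c + d) : a = c := by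
  have h1 := h.2 (Set.add_mem_add ha hd) (Set.add_mem_add hc hb)
    ⟨1/2, 1/2, by norm_num, by norm_num, by norm_num, by
      have : (1/2 : ℝ) • (a + d) + (1/2 : ℝ) • (c + b) = (1/2 : ℝ) • ((a + b) + (c + d)) := by
        module
      rw [this, ← he]; module⟩
  rw [he] at h1
  exact add_right_cancel h1

theorem aux_left {n : ℕ} {P Q : Set (Fin n → ℝ)} {a b : Fin n → ℝ}
    (ha : a ∈ P) (hb : b ∈ Q)
    (h : a + b ∈ (P + Q).extremePoints ℝ) : a ∈ P.extremePoints ℝ := by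
  refine ⟨ha, fun x hx y hy hxy => ?_⟩
  obtain ⟨s, t, hs, ht, hst, rfl⟩ := hxy
  have h1 := h.2 (Set.add_mem_add hx hb) (Set.add_mem_add hy hb)
    ⟨s, t, hs, ht, hst, by
      have : s • (x + b) + t • (y + b) = s • x + t • y + (s + t) • b := by module
      rw [this, hst, one_smul]⟩
  exact add_right_cancel h1

theorem aux_finite {n : ℕ} {P Q : Set (Fin n → ℝ)}
    (hPfin : (P.extremePoints ℝ).Finite) (hQfin : (Q.extremePoints ℝ).Finite) :
    ((P + Q).extremePoints ℝ).Finite := by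
  refine (hPfin.add hQfin).subset ?_
  intro z hz
  obtain ⟨a, ha, b, hb, rfl⟩ := hz.1
  refine Set.add_mem_add (aux_left ha hb hz) (aux_left (Q := P) hb ha ?_)
  rw [add_comm b a, add_comm Q P]; exact hz

theorem aux_exists {n : ℕ} {P Q : Set (Fin n → ℝ)}
    (hPc : IsCompact P) (hPconv : Convex ℝ P)
    (hPfin : (P.extremePoints ℝ).Finite)
    (hQne : Q.Nonempty) (hQc : IsCompact Q)
    {p : Fin n → ℝ} (hp : p ∈ P.extremePoints ℝ) :
    ∃ b ∈ Q, p + b ∈ (P + Q).extremePoints ℝ := by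
  have hsub : convexHull ℝ (P.extremePoints ℝ \ {p}) ⊆ P \ {p} :=
    convexHull_min (fun x hx => ⟨hx.1.1, hx.2⟩)
      ((hPconv.mem_extremePoints_iff_convex_sdiff.1 hp).2)
  have hfin : (P.extremePoints ℝ \ {p}).Finite := hPfin.subset Set.sdiff_subset
  obtain ⟨f, u, hfu, hup⟩ := geometric_hahn_banach_closed_point (convex_convexHull ℝ _)
    (hfin.isClosed_convexHull ℝ) (fun h => (hsub h).2 rfl)
  have hlt : ∀ e ∈ P.extremePoints ℝ, f p ≤ f e → e = p := by
    intro e he hle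
    by_contra hne
    have := hfu e (subset_convexHull ℝ _ ⟨he, hne⟩)
    linarith
  -- the face of `P` in direction `f` is `{p}`
  have hface : f.toExposed P ⊆ {p} := by
    have hexp : IsExposed ℝ P (f.toExposed P) := ContinuousLinearMap.toExposed.isExposed
    have hcomp : IsCompact (f.toExposed P) := hexp.isCompact hPc
    have hKM := closure_convexHull_extremePoints hcomp (hexp.convex hPconv)
    have hE : (f.toExposed P).extremePoints ℝ ⊆ {p} := by
      intro e he
      exact hlt e (hexp.isExtreme.extremePoints_subset_extremePoints he) (he.1.2 p hp.1)
    rw [← hKM]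
    exact closure_minimal (convexHull_min hE (convex_singleton p)) isClosed_singleton
  have hexp : IsExposed ℝ (P + Q) (f.toExposed (P + Q)) := ContinuousLinearMap.toExposed.isExposed
  have hcomp : IsCompact (f.toExposed (P + Q)) := hexp.isCompact (hPc.add hQc)
  have hne : (f.toExposed (P + Q)).Nonempty := by
    obtain ⟨z, hz, hmax⟩ := (hPc.add hQc).exists_isMaxOn (Set.Nonempty.add ⟨p, hp.1⟩ hQne)
      f.continuous.continuousOn
    exact ⟨z, hz, fun y hy => hmax hy⟩
  obtain ⟨z, hz⟩ := hcomp.extremePoints_nonempty hne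
  have hz2 := hexp.isExtreme.extremePoints_subset_extremePoints hz
  obtain ⟨a, ha, b, hb, rfl⟩ := hz2.1
  have hap : a = p := hface ⟨ha, fun y hy => by
    have := hz.1.2 (y + b) (Set.add_mem_add hy hb)
    simpa using this⟩
  subst hap
  exact ⟨b, hb, hz2⟩

theorem aux_le {n : ℕ} {P Q : Set (Fin n → ℝ)}
    (hPc : IsCompact P) (hPconv : Convex ℝ P)
    (hPfin : (P.extremePoints ℝ).Finite)
    (hQne : Q.Nonempty) (hQc : IsCompact Q)
    (hQfin : (Q.extremePoints ℝ).Finite) :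
    (P.extremePoints ℝ).ncard ≤ ((P + Q).extremePoints ℝ).ncard := by
  choose! g hgQ hg using fun p (hp : p ∈ P.extremePoints ℝ) =>
    aux_exists hPc hPconv hPfin hQne hQc hp
  refine Set.ncard_le_ncard_of_injOn (fun p => p + g p) hg ?_ (aux_finite hPfin hQfin)
  intro p hp q hq h
  exact aux_unique hp.1 (hgQ p hp) hq.1 (hgQ q hq) (hg p hp) h

/-- The number of extreme points of the Minkowski sum `P + Q` of two convex
polytopes (nonempty compact convex sets with finitely many extreme points) is at
least the maximum of the numbers of extreme points of `P` and of `Q`. -/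
theorem extremePoints_ncard_add_ge_max
    (n : ℕ) (P Q : Set (Fin n → ℝ))
    (hPne : P.Nonempty) (hPc : IsCompact P) (hPconv : Convex ℝ P)
    (hPfin : (P.extremePoints ℝ).Finite)
    (hQne : Q.Nonempty) (hQc : IsCompact Q) (hQconv : Convex ℝ Q)
    (hQfin : (Q.extremePoints ℝ).Finite) :
    max (P.extremePoints ℝ).ncard (Q.extremePoints ℝ).ncard
      ≤ ((P + Q).extremePoints ℝ).ncard := by
  refine max_le (aux_le hPc hPconv hPfin hQne hQc hQfin) ?_
  rw [add_comm P Q]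
  exact aux_le hQc hQconv hQfin hPne hPc hPfin
end

section
/- Let P be a nonempty compact convex subset of ℝⁿ with finitely many extreme points, and let v be an extreme point of P. Then there exists a linear functional f : ℝⁿ → ℝ such that f(x) < f(v) for every x ∈ P with x ≠ v; that is, every extreme point of a convex polytope is the unique maximizer of some linear functional (equivalently, there is a supporting hyperplane meeting P only at v). -/
/-- Every extreme point of a convex polytope is the unique maximizer of some
linear functional. -/
theorem exists_linear_functional_unique_maximizer
    (n : ℕ) (P : Set (Fin n → ℝ))
    (hPne : P.Nonempty) (hPc : IsCompact P) (hPconv : Convex ℝ P)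
    (hPfin : (P.extremePoints ℝ).Finite)
    (v : Fin n → ℝ) (hv : v ∈ P.extremePoints ℝ) :
    ∃ f : (Fin n → ℝ) →ₗ[ℝ] ℝ, ∀ x ∈ P, x ≠ v → f x < f v := by
  have hP : convexHull ℝ (P.extremePoints ℝ) = P := by
    have h := closure_convexHull_extremePoints hPc hPconv
    rwa [(hPfin.isClosed_convexHull (𝕜 := ℝ)).closure_eq] at h
  have hvQ : v ∉ convexHull ℝ (P.extremePoints ℝ \ {v}) := fun h =>
    (hPconv.mem_extremePoints_iff_mem_sdiff_convexHull_sdiff.1 hv).2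
      (convexHull_mono (Set.sdiff_subset_sdiff_left extremePoints_subset) h)
  obtain ⟨f, u, hf, hu⟩ := geometric_hahn_banach_closed_point (convex_convexHull ℝ _)
    ((hPfin.subset Set.sdiff_subset).isClosed_convexHull (𝕜 := ℝ)) hvQ
  have hS : Convex ℝ {x | x = v ∨ f x < f v} := by
    intro x hx y hy a b ha hb hab
    have hle : ∀ z, (z = v ∨ f z < f v) → f z ≤ f v := by
      rintro z (rfl | h)
      · exact le_rfl
      · exact h.le
    have key : f v = a * f v + b * f v := by rw [← add_mul, hab, one_mul]
    rcases ha.eq_or_lt with rfl | ha'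
    · have : b = 1 := by linarith
      subst this
      simpa using hy
    rcases hb.eq_or_lt with rfl | hb'
    · have : a = 1 := by linarith
      subst this
      simpa using hx
    have h1 := hle x hx
    have h2 := hle y hy
    rcases hx with rfl | hx
    · rcases hy with rfl | hy
      · left
        rw [← add_smul, hab, one_smul]
      · right
        simp only [map_add, map_smul, smul_eq_mul]
        nlinarith [mul_lt_mul_of_pos_left hy hb']
    · right
      simp only [map_add, map_smul, smul_eq_mul]
      nlinarith [mul_lt_mul_of_pos_left hx ha', mul_le_mul_of_nonneg_left h2 hb]
  have hsub : P ⊆ {x | x = v ∨ f x < f v} := by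
    rw [← hP]
    refine convexHull_min (fun x hx => ?_) hS
    by_cases hxv : x = v
    · exact Or.inl hxv
    · exact Or.inr ((hf x (subset_convexHull ℝ _ ⟨hx, hxv⟩)).trans hu)
  exact ⟨f.toLinearMap, fun x hx hne => (hsub hx).resolve_left hne⟩
end

section
/- Let P and Q be nonempty compact convex subsets of ℝⁿ, each with finitely many extreme points, and let v be an extreme point of P. Then there exist a linear functional f : ℝⁿ → ℝ and a point w ∈ Q such that v is the unique maximizer of f on P (f(x) < f(v) for all x ∈ P, x ≠ v) and w is the unique maximizer of f on Q (f(y) < f(w) for all y ∈ Q, y ≠ w). -/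
open Filter Topology in
/-- A strict maximum over the generators is a strict maximum over the convex hull. -/
lemma aux_strict_max {n : ℕ} (S : Set (Fin n → ℝ)) (f : (Fin n → ℝ) →ₗ[ℝ] ℝ) (w : Fin n → ℝ)
    (h : ∀ x ∈ S, x ≠ w → f x < f w) : ∀ x ∈ convexHull ℝ S, x ≠ w → f x < f w := by
  have hc : Convex ℝ {x | x ≠ w → f x < f w} := by
    intro x hx y hy a b ha hb hab hne
    simp only [Set.mem_ofPred_eq] at hx hy
    simp only [map_add, map_smul, smul_eq_mul]
    have hle : ∀ z, (z ≠ w → f z < f w) → f z ≤ f w := by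
      intro z hz
      by_cases hzw : z = w
      · rw [hzw]
      · exact (hz hzw).le
    have hx' := hle x hx
    have hy' := hle y hy
    have hw : f w = a * f w + b * f w := by rw [← add_mul, hab, one_mul]
    rw [hw]
    rcases ha.eq_or_lt with rfl | ha
    · have hb1 : b = 1 := by linarith
      subst hb1
      have : y ≠ w := by simpa using hne
      linarith [hy this]
    rcases hb.eq_or_lt with rfl | hb
    · have hb1 : a = 1 := by linarith
      subst hb1
      have : x ≠ w := by simpa using hne
      linarith [hx this]
    by_cases hxw : x = w
    · have hyw : y ≠ w := by
        rintro rfl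
        apply hne
        rw [hxw, ← add_smul, hab, one_smul]
      have := hy hyw
      nlinarith [mul_lt_mul_of_pos_left this hb, mul_le_mul_of_nonneg_left hx' ha.le]
    · have := hx hxw
      nlinarith [mul_lt_mul_of_pos_left this ha, mul_le_mul_of_nonneg_left hy' hb.le]
  intro x hx
  exact (convexHull_min (fun x hx => h x hx) hc) hx

/-- A compact convex set with finitely many extreme points is their convex hull. -/
lemma aux_hull {n : ℕ} (P : Set (Fin n → ℝ)) (hPc : IsCompact P) (hPconv : Convex ℝ P)
    (hPfin : (P.extremePoints ℝ).Finite) : convexHull ℝ (P.extremePoints ℝ) = P := by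
  have h := closure_convexHull_extremePoints hPc hPconv
  rwa [(hPfin.isCompact_convexHull (𝕜 := ℝ)).isClosed.closure_eq] at h

open Filter Topology in
/-- Given convex polytopes `P`, `Q` and an extreme point `v` of `P`, there are a
linear functional `f` and a point `w ∈ Q` such that `v` is the unique maximizer
of `f` on `P` and `w` is the unique maximizer of `f` on `Q`. -/
theorem exists_common_unique_maximizer
    (n : ℕ) (P Q : Set (Fin n → ℝ))
    (hPne : P.Nonempty) (hPc : IsCompact P) (hPconv : Convex ℝ P)
    (hPfin : (P.extremePoints ℝ).Finite)
    (hQne : Q.Nonempty) (hQc : IsCompact Q) (hQconv : Convex ℝ Q)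
    (hQfin : (Q.extremePoints ℝ).Finite)
    (v : Fin n → ℝ) (hv : v ∈ P.extremePoints ℝ) :
    ∃ (f : (Fin n → ℝ) →ₗ[ℝ] ℝ) (w : Fin n → ℝ), w ∈ Q ∧
      (∀ x ∈ P, x ≠ v → f x < f v) ∧ (∀ y ∈ Q, y ≠ w → f y < f w) := by
  have hP := aux_hull P hPc hPconv hPfin
  have hQ := aux_hull Q hQc hQconv hQfin
  have hnot : v ∉ convexHull ℝ (P.extremePoints ℝ \ {v}) := by
    intro hmem
    have hd := (hPconv.mem_extremePoints_iff_convex_sdiff.1 hv).2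
    have := convexHull_min (Set.sdiff_subset_sdiff_left extremePoints_subset) hd hmem
    exact this.2 rfl
  obtain ⟨g, u, hgu, huv⟩ := geometric_hahn_banach_closed_point (convex_convexHull ℝ _)
    ((hPfin.subset Set.sdiff_subset).isCompact_convexHull (𝕜 := ℝ)).isClosed hnot
  have hg : ∀ x ∈ P.extremePoints ℝ, x ≠ v → g x < g v := fun x hx hxv =>
    (hgu x (subset_convexHull ℝ _ ⟨hx, hxv⟩)).trans huv
  have := hQfin.to_subtype
  obtain ⟨h, hh⟩ := Module.exists_dual_forall_apply_ne_zero (K := ℝ) (M := Fin n → ℝ)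
    (fun p : {p : (Q.extremePoints ℝ) × (Q.extremePoints ℝ) // p.1 ≠ p.2} =>
      (p.1.1 : Fin n → ℝ) - p.1.2)
    (fun p => sub_ne_zero.2 (fun e => p.2 (Subtype.ext e)))
  have hlim : ∀ x : Fin n → ℝ, Tendsto (fun e : ℝ => g x + e * h x) (𝓝[>] 0) (𝓝 (g x)) := by
    intro x
    have : Continuous (fun e : ℝ => g x + e * h x) := by fun_prop
    have h2 := (this.tendsto 0).mono_left (nhdsWithin_le_nhds (s := Set.Ioi 0))
    simpa using h2
  have e1 : ∀ᶠ e in 𝓝[>] (0:ℝ), ∀ x ∈ P.extremePoints ℝ, x ≠ v →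
      g x + e * h x < g v + e * h v := by
    rw [eventually_all_finite hPfin]
    intro x hx
    by_cases hxv : x = v
    · simp [hxv]
    · filter_upwards [(hlim x).eventually_lt (hlim v) (hg x hx hxv)] with e he _ using he
  have e2 : ∀ᶠ e in 𝓝[>] (0:ℝ), ∀ x ∈ Q.extremePoints ℝ, ∀ y ∈ Q.extremePoints ℝ, x ≠ y →
      g x + e * h x ≠ g y + e * h y := by
    rw [eventually_all_finite hQfin]
    intro x hx
    rw [eventually_all_finite hQfin]
    intro y hy
    by_cases hxy : x = y
    · simp [hxy]
    have hne : h x - h y ≠ 0 := by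
      have := hh ⟨(⟨x, hx⟩, ⟨y, hy⟩), fun e => hxy (congrArg Subtype.val e)⟩
      simpa using this
    rcases lt_trichotomy (g x) (g y) with hlt | heq | hlt
    · filter_upwards [(hlim x).eventually_lt (hlim y) hlt] with e he _ using he.ne
    · filter_upwards [self_mem_nhdsWithin] with e he _ hc
      rw [heq] at hc
      have : e * (h x - h y) = 0 := by linarith
      exact (mul_ne_zero (ne_of_gt he) hne) this
    · filter_upwards [(hlim y).eventually_lt (hlim x) hlt] with e he _ using he.ne'
  obtain ⟨e, he1, he2⟩ := (e1.and e2).exists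
  have hQEne : (Q.extremePoints ℝ).Nonempty := hQc.extremePoints_nonempty hQne
  let f : (Fin n → ℝ) →ₗ[ℝ] ℝ := (g : (Fin n → ℝ) →ₗ[ℝ] ℝ) + e • h
  have hf : ∀ x, f x = g x + e * h x := fun x => by simp [f]
  obtain ⟨w, hw, hmax⟩ := Set.exists_max_image _ f hQfin hQEne
  refine ⟨f, w, extremePoints_subset hw, ?_, ?_⟩
  · rw [← hP]
    apply aux_strict_max
    intro x hx hxv
    rw [hf, hf]
    exact he1 x hx hxv
  · rw [← hQ]
    apply aux_strict_max
    intro y hy hyw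
    refine lt_of_le_of_ne (hmax y hy) ?_
    rw [hf, hf]
    exact he2 y hy w hw hyw
end

section
/- Let P be a nonempty compact convex subset of ℝˡ with finitely many extreme points. Then the Minkowski sum P + [-1,1]ˡ of P with the cube [-1,1]ˡ has at least 2ˡ extreme points. -/
open Pointwise

/-- The sign vector attached to a Boolean vector. -/
def signVec {l : ℕ} (b : Fin l → Bool) : Fin l → ℝ := fun i => if b i then 1 else -1

theorem signVec_inj {l : ℕ} : Function.Injective (signVec (l := l)) := by
  intro a b h
  funext i
  have hi := congrFun h i
  simp only [signVec] at hi
  cases ha : a i <;> cases hb : b i <;> simp [ha, hb] at hi ⊢ <;> norm_num at hi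

theorem signVec_mem {l : ℕ} (b : Fin l → Bool) :
    signVec b ∈ Set.Icc (fun _ : Fin l => (-1 : ℝ)) fun _ => 1 := by
  constructor <;> intro i <;> simp only [signVec] <;> split_ifs <;> norm_num

theorem exists_vertex {l : ℕ} {P : Set (Fin l → ℝ)} (hPne : P.Nonempty) (hPc : IsCompact P)
    (b : Fin l → Bool) :
    ∃ p ∈ P, p + signVec b ∈
      (P + Set.Icc (fun _ : Fin l => (-1 : ℝ)) fun _ => 1).extremePoints ℝ := by
  set C := Set.Icc (fun _ : Fin l => (-1 : ℝ)) fun _ => 1 with hC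
  have hcomp : IsCompact (P + C) := hPc.add isCompact_Icc
  let f : StrongDual ℝ (Fin l → ℝ) :=
    ∑ i, signVec b i • (ContinuousLinearMap.proj (R := ℝ) (φ := fun _ : Fin l => ℝ) i)
  have hf : ∀ x, f x = ∑ i, signVec b i * x i := by
    intro x; simp [f]
  have hexp : IsExposed ℝ (P + C) (f.toExposed (P + C)) :=
    ContinuousLinearMap.toExposed.isExposed
  have hne : (f.toExposed (P + C)).Nonempty := by
    obtain ⟨x, hx, hm⟩ := hcomp.exists_isMaxOn (hPne.add ⟨_, signVec_mem b⟩) f.continuous.continuousOn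
    exact ⟨x, hx, fun y hy => hm hy⟩
  obtain ⟨v, hv⟩ := (hexp.isCompact hcomp).extremePoints_nonempty hne
  have hvE := hexp.isExtreme.extremePoints_subset_extremePoints hv
  obtain ⟨hvm, hmax⟩ := hv.1
  obtain ⟨p, hp, q, hq, rfl⟩ := hvm
  have h1 := hmax (p + signVec b) (Set.add_mem_add hp (signVec_mem b))
  have hle : ∀ i ∈ Finset.univ, signVec b i * q i ≤ signVec b i * signVec b i := by
    intro i _
    have := hq.1 i
    have := hq.2 i
    simp only [signVec]
    split_ifs <;> linarith
  have heq : ∀ i, signVec b i * q i = signVec b i * signVec b i := by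
    have h2 : f (signVec b) ≤ f q := by
      simp only [map_add] at h1
      linarith
    rw [hf, hf] at h2
    have := (Finset.sum_eq_sum_iff_of_le hle).1 (le_antisymm (Finset.sum_le_sum hle) h2)
    exact fun i => this i (Finset.mem_univ i)
  have hqs : q = signVec b := by
    funext i
    have := heq i
    simp only [signVec] at this ⊢
    split_ifs at this ⊢ <;> linarith
  subst hqs
  exact ⟨p, hp, hvE⟩

theorem cube_ext_finite (l : ℕ) :
    ((Set.Icc (fun _ : Fin l => (-1 : ℝ)) fun _ => 1).extremePoints ℝ).Finite := by
  refine (Set.finite_range (signVec (l := l))).subset ?_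
  intro q hq
  rw [← Set.pi_univ_Icc, extremePoints_pi] at hq
  refine ⟨fun i => decide (q i = 1), ?_⟩
  funext i
  have hi := hq i (Set.mem_univ i)
  obtain ⟨⟨ha, hb⟩, hi⟩ := hi
  simp only [signVec, decide_eq_true_eq]
  split_ifs with h
  · exact h.symm
  · by_contra h'
    have h1 : q i < 1 := lt_of_le_of_ne hb h
    have h2 : -1 < q i := lt_of_le_of_ne ha h'
    have := hi (x₁ := -1) (by norm_num) (x₂ := 1) (by norm_num)
      (by rw [openSegment_eq_Ioo (by norm_num)]; exact ⟨h2, h1⟩)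
    simp_all

theorem ext_add_subset {l : ℕ} (P Q : Set (Fin l → ℝ)) :
    (P + Q).extremePoints ℝ ⊆ P.extremePoints ℝ + Q.extremePoints ℝ := by
  rintro v ⟨⟨p, hp, q, hq, rfl⟩, hv⟩
  refine ⟨p, ⟨hp, ?_⟩, q, ⟨hq, ?_⟩, rfl⟩
  · rintro x hx y hy ⟨a, b, ha, hb, hab, h⟩
    have := hv (Set.add_mem_add hx hq) (Set.add_mem_add hy hq)
      ⟨a, b, ha, hb, hab, by rw [← h, smul_add, smul_add, add_add_add_comm, ← add_smul, hab, one_smul]⟩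
    simpa using this
  · rintro x hx y hy ⟨a, b, ha, hb, hab, h⟩
    have := hv (Set.add_mem_add hp hx) (Set.add_mem_add hp hy)
      ⟨a, b, ha, hb, hab, by rw [← h, smul_add, smul_add, add_add_add_comm, ← add_smul, hab, one_smul]⟩
    simpa using this

/-- The Minkowski sum of a convex polytope in `ℝˡ` with the cube `[-1,1]ˡ` has
at least `2ˡ` extreme points. -/
theorem extremePoints_add_cube_ge
    (l : ℕ) (P : Set (Fin l → ℝ))
    (hPne : P.Nonempty) (hPc : IsCompact P) (hPconv : Convex ℝ P)
    (hPfin : (P.extremePoints ℝ).Finite) :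
    2 ^ l ≤
      ((P + Set.Icc (fun _ : Fin l => (-1 : ℝ)) fun _ => 1).extremePoints ℝ).ncard := by
  have hfin := (hPfin.add (cube_ext_finite l)).subset
    (ext_add_subset P (Set.Icc (fun _ : Fin l => (-1 : ℝ)) fun _ => 1))
  choose p hp hv using fun b => exists_vertex hPne hPc b
  have hinj : Function.Injective fun b => p b + signVec b := by
    intro s t h
    have h : p s + signVec s = p t + signVec t := h
    apply signVec_inj
    have := (hv s).2 (Set.add_mem_add (hp s) (signVec_mem t))
      (Set.add_mem_add (hp t) (signVec_mem s))
      ⟨1/2, 1/2, by norm_num, by norm_num, by norm_num, by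
        rw [← smul_add]
        have : p s + signVec t + (p t + signVec s)
            = (2 : ℝ) • (p s + signVec s) := by
          rw [two_smul]; nth_rewrite 2 [h]; abel
        rw [this, smul_smul]; norm_num⟩
    exact (by simpa using this : signVec t = signVec s).symm
  have hc : (Set.range fun b => p b + signVec b).ncard = 2 ^ l := by
    rw [← Set.image_univ, Set.ncard_image_of_injective _ hinj, Set.ncard_univ]
    simp
  rw [← hc]
  exact Set.ncard_le_ncard (Set.range_subset_iff.2 hv) hfin
end

section
/- Let P be a nonempty compact convex subset of ℝˡ with finitely many extreme points, and suppose the Minkowski sum P + [-1,1]ˡ has exactly 2ˡ extreme points. Then P + [-1,1]ˡ is a box with edges parallel to the coordinate axes: there exist a, b ∈ ℝˡ with aᵢ + 2 ≤ bᵢ for every i such that P + [-1,1]ˡ = {x ∈ ℝˡ : aᵢ ≤ xᵢ ≤ bᵢ for all i}. -/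
open Pointwise

/-- The sign vector of a boolean vector. -/
def sgnVec {l : ℕ} (s : Fin l → Bool) : Fin l → ℝ := fun i => if s i then 1 else -1

lemma sgnVec_mem {l : ℕ} (s : Fin l → Bool) :
    sgnVec s ∈ Set.Icc (fun _ : Fin l => (-1 : ℝ)) (fun _ => 1) := by
  constructor <;> intro i <;> by_cases h : s i <;> simp [sgnVec, h]

lemma sgnVec_inj {l : ℕ} {s t : Fin l → Bool} (h : sgnVec s = sgnVec t) : s = t := by
  funext i
  have := congrFun h i
  simp only [sgnVec] at this
  cases hs : s i <;> cases ht : t i <;> simp [hs, ht] at this ⊢ <;> norm_num at this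

/-- Uniqueness of decomposition of an extreme point of a sum. -/
lemma decomp_unique {l : ℕ} {P C : Set (Fin l → ℝ)} {v c d : Fin l → ℝ}
    (hv : v ∈ (P + C).extremePoints ℝ) (hc : c ∈ C) (hd : d ∈ C)
    (hcP : v - c ∈ P) (hdP : v - d ∈ P) : c = d := by
  have h1 : (v - c) + d ∈ P + C := Set.add_mem_add hcP hd
  have h2 : (v - d) + c ∈ P + C := Set.add_mem_add hdP hc
  have h := hv.2 h1 h2 ⟨1/2, 1/2, by norm_num, by norm_num, by norm_num, by
    ext i; simp; ring⟩
  ext i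
  have := congrFun h i
  simp at this
  linarith

lemma exists_ext {l : ℕ} {P : Set (Fin l → ℝ)} (hPne : P.Nonempty) (hPc : IsCompact P)
    (s : Fin l → Bool) (w : Fin l → ℝ) (hw : ∀ i, 0 < w i * sgnVec s i) :
    ∃ v ∈ (P + Set.Icc (fun _ : Fin l => (-1 : ℝ)) fun _ => 1).extremePoints ℝ,
      v - sgnVec s ∈ P ∧
      ∀ x ∈ P + Set.Icc (fun _ : Fin l => (-1 : ℝ)) fun _ => 1,
        ∑ i, w i * x i ≤ ∑ i, w i * v i := by
  set C := Set.Icc (fun _ : Fin l => (-1 : ℝ)) fun _ => 1 with hC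
  have hQ : IsCompact (P + C) := hPc.add isCompact_Icc
  have hQne : (P + C).Nonempty := hPne.add ⟨_, sgnVec_mem s⟩
  let f : (Fin l → ℝ) →L[ℝ] ℝ := ∑ i, w i • ContinuousLinearMap.proj i
  have hf : ∀ x, f x = ∑ i, w i * x i := by
    intro x; simp [f]
  have hexp : IsExposed ℝ (P + C) (f.toExposed (P + C)) :=
    ContinuousLinearMap.toExposed.isExposed
  have hcomp : IsCompact (f.toExposed (P + C)) := hexp.isCompact hQ
  obtain ⟨y, hy, hymax⟩ := hQ.exists_isMaxOn hQne f.continuous.continuousOn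
  have hne : (f.toExposed (P + C)).Nonempty := ⟨y, hy, fun z hz => hymax hz⟩
  obtain ⟨v, hv⟩ := hcomp.extremePoints_nonempty hne
  have hvE : v ∈ (P + C).extremePoints ℝ := hexp.isExtreme.extremePoints_subset_extremePoints hv
  have hvmax : ∀ x ∈ P + C, ∑ i, w i * x i ≤ ∑ i, w i * v i := by
    intro x hx
    rw [← hf, ← hf]; exact hv.1.2 x hx
  refine ⟨v, hvE, ?_, hvmax⟩
  obtain ⟨p, hp, c, hc, hpc⟩ := Set.mem_add.1 hvE.1
  have h1 := hvmax (p + sgnVec s) (Set.add_mem_add hp (sgnVec_mem s))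
  have hnn : ∀ i, 0 ≤ w i * (sgnVec s i - c i) := by
    intro i
    have h1 := hc.1 i
    have h2 := hc.2 i
    have h3 := hw i
    simp only [sgnVec] at h3 ⊢
    simp only at h1 h2
    split_ifs at h3 ⊢ <;> nlinarith
  have hsum : ∑ i, w i * (sgnVec s i - c i) = 0 := by
    apply le_antisymm _ (Finset.sum_nonneg fun i _ => hnn i)
    rw [← hpc] at h1
    simp only [Pi.add_apply, mul_add, Finset.sum_add_distrib] at h1
    simp only [mul_sub, Finset.sum_sub_distrib]
    linarith
  have hz := (Finset.sum_eq_zero_iff_of_nonneg fun i _ => hnn i).1 hsum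
  have hcs : c = sgnVec s := by
    ext i
    have h0 : w i ≠ 0 := by
      intro h; have := hw i; simp [h] at this
    have := (mul_eq_zero.1 (hz i (Finset.mem_univ i))).resolve_left h0
    linarith
  rw [← hcs, ← hpc]; simpa using hp

/-- If the Minkowski sum of a convex polytope `P ⊆ ℝˡ` with the cube `[-1,1]ˡ`
has exactly `2ˡ` extreme points, then it is a box with edges parallel to the
coordinate axes. -/
theorem add_cube_eq_box_of_ncard_extremePoints
    (l : ℕ) (P : Set (Fin l → ℝ))
    (hPne : P.Nonempty) (hPc : IsCompact P) (hPconv : Convex ℝ P)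
    (hPfin : (P.extremePoints ℝ).Finite)
    (hcard :
      ((P + Set.Icc (fun _ : Fin l => (-1 : ℝ)) fun _ => 1).extremePoints ℝ).ncard
        = 2 ^ l) :
    ∃ a b : Fin l → ℝ, (∀ i, a i + 2 ≤ b i) ∧
      P + Set.Icc (fun _ : Fin l => (-1 : ℝ)) (fun _ => 1) = Set.Icc a b := by
  have hss : ∀ (s : Fin l → Bool) i, sgnVec s i * sgnVec s i = 1 := by
    intro s i; by_cases h : s i <;> simp [sgnVec, h]
  have key := fun s : Fin l → Bool => exists_ext hPne hPc s (sgnVec s)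
    (fun i => by rw [hss]; norm_num)
  choose g hgE hgP _ using key
  set C := Set.Icc (fun _ : Fin l => (-1 : ℝ)) fun _ => 1 with hC
  have hfin : ((P + C).extremePoints ℝ).Finite :=
    Set.finite_of_ncard_ne_zero (by rw [hcard]; positivity)
  have hginj : Function.Injective g := by
    intro s t h
    exact sgnVec_inj (decomp_unique (hgE s) (sgnVec_mem s) (sgnVec_mem t) (hgP s)
      (by rw [h]; exact hgP t))
  have hrange : Set.range g = (P + C).extremePoints ℝ := by
    apply Set.eq_of_subset_of_ncard_le _ _ hfin
    · rintro _ ⟨s, rfl⟩; exact hgE s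
    · rw [hcard, ← Set.image_univ, Set.ncard_image_of_injective _ hginj, Set.ncard_univ]
      simp
  have hmax : ∀ (s : Fin l → Bool) (w : Fin l → ℝ), (∀ i, 0 < w i * sgnVec s i) →
      ∀ x ∈ P + C, ∑ i, w i * x i ≤ ∑ i, w i * g s i := by
    intro s w hw
    obtain ⟨v, hvE, hvP, hvm⟩ := exists_ext hPne hPc s w hw
    obtain ⟨t, rfl⟩ : v ∈ Set.range g := by rw [hrange]; exact hvE
    have : s = t := sgnVec_inj
      (decomp_unique hvE (sgnVec_mem s) (sgnVec_mem t) hvP (hgP t))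
    rw [this]; exact hvm
  have hcoord : ∀ (s : Fin l → Bool) (i : Fin l), ∀ x ∈ P + C,
      sgnVec s i * x i ≤ sgnVec s i * g s i := by
    intro s i x hx
    by_contra! hlt
    set A := ∑ j, sgnVec s j * x j
    set B := ∑ j, sgnVec s j * g s j
    have hε : ∀ ε : ℝ, 0 < ε → sgnVec s i * x i + ε * A ≤ sgnVec s i * g s i + ε * B := by
      intro ε he
      have := hmax s (fun j => (if j = i then sgnVec s i else 0) + ε * sgnVec s j) (by
        intro j
        have h := hss s j
        by_cases hj : j = i
        · subst hj; simp only [if_true]; nlinarith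
        · simp only [hj, if_false]; nlinarith) x hx
      simpa [add_mul, Finset.sum_add_distrib, ite_mul, mul_assoc, ← Finset.mul_sum] using this
    set δ := sgnVec s i * x i - sgnVec s i * g s i with hδ
    have hδ0 : 0 < δ := by linarith
    have h := hε (δ / (2 * (|B - A| + 1))) (by positivity)
    have h2 : δ / (2 * (|B - A| + 1)) * (B - A) ≤ δ / 2 := by
      have h3 := le_abs_self (B - A)
      have h4 := abs_nonneg (B - A)
      rw [div_mul_eq_mul_div, div_le_div_iff₀ (by positivity) (by norm_num)]
      nlinarith
    nlinarith
  have hgQ : ∀ s, g s ∈ P + C := fun s => (hgE s).1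
  have hup : ∀ (s : Fin l → Bool) i, s i = true → ∀ x ∈ P + C, x i ≤ g s i := by
    intro s i hs x hx
    have := hcoord s i x hx
    simpa [sgnVec, hs] using this
  have hlo : ∀ (s : Fin l → Bool) i, s i = false → ∀ x ∈ P + C, g s i ≤ x i := by
    intro s i hs x hx
    have := hcoord s i x hx
    simpa [sgnVec, hs] using this
  refine ⟨g fun _ => false, g fun _ => true, ?_, ?_⟩
  · intro i
    obtain ⟨p, hp⟩ := hPne
    have h1 := hup (fun _ => true) i rfl _ (Set.add_mem_add hp (sgnVec_mem fun _ => true))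
    have h2 := hlo (fun _ => false) i rfl _ (Set.add_mem_add hp (sgnVec_mem fun _ => false))
    simp [sgnVec] at h1 h2
    linarith
  · apply Set.Subset.antisymm
    · intro x hx
      exact ⟨fun i => hlo _ i rfl x hx, fun i => hup _ i rfl x hx⟩
    · have hconv : Convex ℝ (P + C) := hPconv.add (convex_Icc _ _)
      have hle : ∀ i, g (fun _ => false) i ≤ g (fun _ => true) i :=
        fun i => hlo _ i rfl _ (hgQ _)
      have hbox : Set.Icc (g fun _ => false) (g fun _ => true) =
          convexHull ℝ (Set.univ.pi fun i =>
            ({g (fun _ => false) i, g (fun _ => true) i} : Set ℝ)) := by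
        rw [convexHull_pi, ← Set.pi_univ_Icc]
        congr 1
        funext i
        rw [convexHull_pair, segment_eq_Icc (hle i)]
      rw [hbox]
      apply convexHull_min _ hconv
      intro x hx
      classical
      let s : Fin l → Bool := fun i => decide (x i = g (fun _ => true) i)
      have : x = g s := by
        ext i
        by_cases h : x i = g (fun _ => true) i
        · have hs : s i = true := by simp [s, h]
          rw [h]
          exact le_antisymm (hup s i hs _ (hgQ _)) (hup _ i rfl _ (hgQ _))
        · have hs : s i = false := by simp [s, h]
          have hx' : x i = g (fun _ => false) i := by
            have := hx i (Set.mem_univ i)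
            simp only [Set.mem_insert_iff, Set.mem_singleton_iff] at this
            tauto
          rw [hx']
          exact le_antisymm (hlo _ i rfl _ (hgQ _)) (hlo s i hs _ (hgQ _))
      rw [this]; exact hgQ s
end

section
/- Let F be a field, A = F[X]/(X²) the ring of dual numbers over F, and M an A-module that is finite-dimensional as an F-vector space. Let e : M → M be the F-linear endomorphism given by multiplication by X. Then M is free as an A-module if and only if ker(e) = im(e). -/
theorem dual_smul_aux
    (F : Type*) [Field F] (M : Type*) [AddCommGroup M]
    [Module (DualNumber F) M] [Module F M]
    [IsScalarTower F (DualNumber F) M] (a : DualNumber F) (m : M) :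
    a • m = a.fst • m + a.snd • ((DualNumber.eps : DualNumber F) • m) := by
  have h : a = a.fst • (1 : DualNumber F) + a.snd • (DualNumber.eps : DualNumber F) := by
    ext <;> simp
  conv_lhs => rw [h]
  rw [add_smul, smul_assoc, smul_assoc, one_smul]

/-- A module `M` over the dual numbers `A = F[X]/(X²)` that is finite-dimensional
over `F` is free over `A` if and only if the kernel of multiplication by the
nilpotent generator `ε` equals its image. -/
theorem free_iff_ker_eq_range_eps
    (F : Type*) [Field F] (M : Type*) [AddCommGroup M]
    [Module (DualNumber F) M] [Module F M]
    [IsScalarTower F (DualNumber F) M] [FiniteDimensional F M]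
    (e : M →ₗ[F] M) (he : ∀ m : M, e m = (DualNumber.eps : DualNumber F) • m) :
    Module.Free (DualNumber F) M ↔ LinearMap.ker e = LinearMap.range e := by
  have hee : ∀ m, e (e m) = 0 := by
    intro m
    rw [he, he, smul_smul, DualNumber.eps_mul_eps, zero_smul]
  have hs : ∀ (a : DualNumber F) (m : M), a • m = a.fst • m + a.snd • e m := by
    intro a m
    rw [he]; exact dual_smul_aux F M a m
  constructor
  · intro hfree
    apply le_antisymm
    · intro m hm
      let b := Module.Free.chooseBasis (DualNumber F) M
      rw [LinearMap.mem_ker, he] at hm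
      let g := (b.repr m).mapRange
        (fun a : DualNumber F => (TrivSqZeroExt.inl a.snd : DualNumber F)) (by simp)
      refine ⟨b.repr.symm g, ?_⟩
      rw [he]
      apply b.repr.injective
      rw [map_smul, LinearEquiv.apply_symm_apply]
      have h0 : (DualNumber.eps : DualNumber F) • b.repr m = 0 := by
        rw [← map_smul, hm, map_zero]
      ext i
      · have := congrArg TrivSqZeroExt.snd (DFunLike.congr_fun h0 i)
        simp at this
        simp [g, this]
      · simp [g]
        erw [Finsupp.mapRange_apply]
        rfl
    · rintro _ ⟨m, rfl⟩
      exact hee m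
  · intro hk
    let v := Module.finBasis F (LinearMap.range e)
    have hw : ∀ i, ∃ w, e w = (v i : M) := fun i => (v i).2
    choose w hw using hw
    have hv : ∀ c : Fin _ → F, ∑ i, c i • (v i : M) = 0 → ∀ i, c i = 0 := by
      intro c hc
      apply Fintype.linearIndependent_iff.1 v.linearIndependent c
      apply Subtype.ext
      simpa using hc
    have hsp : ∀ m ∈ LinearMap.range e, ∃ c : Fin _ → F, m = ∑ i, c i • (v i : M) := by
      intro m hm
      refine ⟨fun i => v.repr ⟨m, hm⟩ i, ?_⟩
      have := congrArg Subtype.val (v.sum_repr ⟨m, hm⟩)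
      rw [Submodule.coe_sum] at this
      exact this.symm
    have hev : ∀ i, e (v i : M) = 0 := fun i => by rw [← hw, hee]
    have hli : LinearIndependent (DualNumber F) w := by
      rw [Fintype.linearIndependent_iff]
      intro g hg
      simp only [hs, hw] at hg
      have h1 : ∀ i, (g i).fst = 0 := by
        apply hv
        have := congrArg e hg
        simpa [map_sum, hw, hev] using this
      have h2 : ∀ i, (g i).snd = 0 := by
        apply hv
        simpa [h1] using hg
      intro i
      ext
      · exact h1 i
      · exact h2 i
    refine Module.Free.of_basis (Module.Basis.mk hli ?_)
    intro m _
    obtain ⟨a, ha⟩ := hsp (e m) ⟨m, rfl⟩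
    have hmem : m - ∑ i, a i • w i ∈ LinearMap.range e := by
      apply hk.le
      rw [LinearMap.mem_ker, map_sub, ha]
      simp [map_sum, hw]
    obtain ⟨c, hc⟩ := hsp _ hmem
    have : m = ∑ i, ((TrivSqZeroExt.inl (a i) + TrivSqZeroExt.inr (c i) : DualNumber F)) • w i := by
      simp only [hs, hw]
      simp only [TrivSqZeroExt.fst_add, TrivSqZeroExt.snd_add, TrivSqZeroExt.fst_inl,
        TrivSqZeroExt.fst_inr, TrivSqZeroExt.snd_inl, TrivSqZeroExt.snd_inr, add_zero, zero_add,
        Finset.sum_add_distrib, ← hc]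
      abel
    rw [this]
    exact Submodule.sum_mem _ fun i _ =>
      Submodule.smul_mem _ _ (Submodule.subset_span ⟨i, rfl⟩)
end
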